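/- arXiv:2412.16714 — 6 statements merged into one kernel-verified Lean document; each statement's English description precedes it below -/
import Mathlib

section
/- Truncated ℓ¹-stability (key step of the jump-distance / support stability lemma): for every real K ≥ 0 and every pair of configurations η, ζ ∈ ℕ^T, the coupling generator applied to the function Ψ_K(η,ζ) := max( Σ_{z∈T} |η_z − ζ_z| − K, 0 ) satisfies L̃Ψ_K(η,ζ) ≤ 0. -/
open Finset

/-- The discrete torus `(ℤ/Nℤ)^d`. -/
abbrev Torus (d N : ℕ) := Fin d → ZMod N

/-- The configuration `η^{xy}` obtained from `η` by moving one particle from `x` to `y`. -/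
def move {T : Type*} [DecidableEq T] (η : T → ℕ) (x y : T) : T → ℕ :=
  fun z => if z = x then η x - 1 else if z = y then η y + 1 else η z

/-- The zero-range coupling generator `L̃` applied to a two-variable function `Ψ`. -/
noncomputable def couplingGen {T : Type*} [Fintype T] [DecidableEq T] [Sub T]
    (p : T → ℝ) (g : ℕ → ℝ) (Ψ : (T → ℕ) → (T → ℕ) → ℝ) (η ζ : T → ℕ) : ℝ :=
  ∑ x : T, ∑ y : T, p (y - x) *
    ( (min (g (η x)) (g (ζ x))) * (Ψ (move η x y) (move ζ x y) - Ψ η ζ)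
    + (g (η x) - min (g (η x)) (g (ζ x))) * (Ψ (move η x y) ζ - Ψ η ζ)
    + (g (ζ x) - min (g (η x)) (g (ζ x))) * (Ψ η (move ζ x y) - Ψ η ζ) )

/-- Moving a particle away from a site where `η` exceeds `ζ` does not increase the
`ℓ¹`-distance between `η` and `ζ`. -/
theorem sum_abs_move_sub_le {T : Type*} [Fintype T] [DecidableEq T] (η ζ : T → ℕ) {x y : T}
    (hxy : x ≠ y) (h : ζ x < η x) :
    ∑ z, |(move η x y z : ℝ) - (ζ z : ℝ)| ≤ ∑ z, |(η z : ℝ) - (ζ z : ℝ)| := by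
  have hpt : ∀ z, |(move η x y z : ℝ) - (ζ z : ℝ)| ≤ |(η z : ℝ) - (ζ z : ℝ)|
      + ((if z = y then 1 else 0) - (if z = x then 1 else 0)) := by
    intro z
    unfold move
    by_cases hzx : z = x
    · subst hzx
      have h1 : (ζ z : ℝ) + 1 ≤ η z := by exact_mod_cast h
      have h2 : 1 ≤ η z := by omega
      simp only [if_true, if_neg hxy]
      rw [Nat.cast_sub h2, Nat.cast_one, abs_of_nonneg (by linarith),
        abs_of_nonneg (by linarith)]
      linarith
    · by_cases hzy : z = y
      · subst hzy
        simp only [if_true, if_neg hzx]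
        push_cast
        calc |(η z : ℝ) + 1 - ζ z| = |((η z : ℝ) - ζ z) + 1| := by ring_nf
          _ ≤ |(η z : ℝ) - ζ z| + |(1 : ℝ)| := abs_add_le _ _
          _ = _ := by simp
      · simp [hzx, hzy]
  calc ∑ z, |(move η x y z : ℝ) - (ζ z : ℝ)|
      ≤ ∑ z, (|(η z : ℝ) - (ζ z : ℝ)|
        + ((if z = y then 1 else 0) - (if z = x then 1 else 0))) :=
        Finset.sum_le_sum fun z _ => hpt z
    _ = _ := by simp [Finset.sum_add_distrib, Finset.sum_sub_distrib]

/-- Moving a particle along the same bond in both configurations preserves their differences. -/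
theorem move_sub_move {T : Type*} [DecidableEq T] (η ζ : T → ℕ) {x : T} (y : T)
    (hη : 1 ≤ η x) (hζ : 1 ≤ ζ x) (hxy : x ≠ y) (z : T) :
    (move η x y z : ℝ) - (move ζ x y z : ℝ) = (η z : ℝ) - (ζ z : ℝ) := by
  unfold move
  by_cases hzx : z = x
  · subst hzx
    simp [Nat.cast_sub hη, Nat.cast_sub hζ]
  · by_cases hzy : z = y
    · subst hzy
      simp [hzx]
    · simp [hzx, hzy]

/-- Truncated ℓ¹-stability: for every `K ≥ 0`, the coupling generator applied to
`Ψ_K(η,ζ) = max(Σ_z |η_z − ζ_z| − K, 0)` is nonpositive. -/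
theorem zrp_coupling_truncated_ell1_stability (d N : ℕ) (hd : 1 ≤ d) (hN : 1 ≤ N) [NeZero N]
    (p : Torus d N → ℝ) (hp : ∀ x, 0 ≤ p x) (hp0 : p 0 = 0)
    (hpsum : ∑ x : Torus d N, p x = 1)
    (g : ℕ → ℝ) (hgnonneg : ∀ k, 0 ≤ g k) (hgmono : Monotone g) (hg0 : g 0 = 0)
    (K : ℝ) (hK : 0 ≤ K) (η ζ : Torus d N → ℕ) :
    couplingGen p g
      (fun η ζ => max ((∑ z : Torus d N, |(η z : ℝ) - (ζ z : ℝ)|) - K) 0) η ζ ≤ 0 := by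
  unfold couplingGen
  refine Finset.sum_nonpos fun x _ => Finset.sum_nonpos fun y _ => ?_
  by_cases hxy : x = y
  · subst hxy
    simp [hp0]
  refine mul_nonpos_of_nonneg_of_nonpos (hp _) ?_
  have hjoint : min (g (η x)) (g (ζ x)) *
      (max ((∑ z, |(move η x y z : ℝ) - (move ζ x y z : ℝ)|) - K) 0
        - max ((∑ z, |(η z : ℝ) - (ζ z : ℝ)|) - K) 0) = 0 := by
    rcases Nat.eq_zero_or_pos (η x) with h | hη
    · simp [h, hg0, hgnonneg]
    rcases Nat.eq_zero_or_pos (ζ x) with h | hζ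
    · simp [h, hg0, hgnonneg]
    simp only [move_sub_move η ζ y hη hζ hxy, sub_self, mul_zero]
  have hleft : (g (η x) - min (g (η x)) (g (ζ x))) *
      (max ((∑ z, |(move η x y z : ℝ) - (ζ z : ℝ)|) - K) 0
        - max ((∑ z, |(η z : ℝ) - (ζ z : ℝ)|) - K) 0) ≤ 0 := by
    rcases le_or_gt (η x) (ζ x) with h | h
    · simp [min_eq_left (hgmono h)]
    · exact mul_nonpos_of_nonneg_of_nonpos (sub_nonneg.2 (min_le_left _ _))
        (sub_nonpos.2 (max_le_max_right _ (sub_le_sub_right (sum_abs_move_sub_le η ζ hxy h) _)))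
  have hright : (g (ζ x) - min (g (η x)) (g (ζ x))) *
      (max ((∑ z, |(η z : ℝ) - (move ζ x y z : ℝ)|) - K) 0
        - max ((∑ z, |(η z : ℝ) - (ζ z : ℝ)|) - K) 0) ≤ 0 := by
    rcases le_or_gt (ζ x) (η x) with h | h
    · simp [min_eq_right (hgmono h)]
    · have hle := sum_abs_move_sub_le ζ η hxy h
      simp only [abs_sub_comm (_ : ℝ) (η _ : ℝ)] at hle
      exact mul_nonpos_of_nonneg_of_nonpos (sub_nonneg.2 (min_le_right _ _))
        (sub_nonpos.2 (max_le_max_right _ (sub_le_sub_right hle _)))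
  exact add_nonpos (add_nonpos hjoint.le hleft) hright
end

section
/- Entropy–Dirichlet comparison for jump generators: for every positive function F : S → ℝ (F(η) > 0 for all η), one has Σ_{η∈S} θ(η) F(η) (L(ln F))(η) ≤ 2 Σ_{η∈S} θ(η) √(F(η)) (L(√F))(η). -/
open Finset Real

/-- The inequality `log t ≤ t - 1` at `t = √b / √a`, with denominators cleared. -/
theorem mul_log_sub_log_le_two_mul_sqrt {a b : ℝ} (ha : 0 < a) (hb : 0 < b) :
    a * (Real.log b - Real.log a) ≤ 2 * (Real.sqrt a * (Real.sqrt b - Real.sqrt a)) := by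
  have hsa := Real.sqrt_pos.2 ha
  have hsb := Real.sqrt_pos.2 hb
  have hlog := Real.log_le_sub_one_of_pos (div_pos hsb hsa)
  rw [Real.log_div hsb.ne' hsa.ne', Real.log_sqrt hb.le, Real.log_sqrt ha.le] at hlog
  calc a * (Real.log b - Real.log a)
      ≤ a * (2 * (Real.sqrt b / Real.sqrt a - 1)) :=
        mul_le_mul_of_nonneg_left (by linarith) ha.le
    _ = Real.sqrt a ^ 2 * (2 * (Real.sqrt b / Real.sqrt a - 1)) := by rw [Real.sq_sqrt ha.le]
    _ = 2 * (Real.sqrt a * (Real.sqrt b - Real.sqrt a)) := by field_simp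

/-- Entropy–Dirichlet comparison for jump generators: for a nonnegative rate
kernel `c`, a nonnegative weight `θ` and a positive function `F`,
`Σ θ F L(ln F) ≤ 2 Σ θ √F L(√F)`, where `(Lφ)(η) = Σ_ζ c(η,ζ)(φ(ζ) − φ(η))`. -/
theorem entropy_dirichlet_comparison {S : Type*} [Fintype S]
    (c : S × S → ℝ) (hc : ∀ q, 0 ≤ c q)
    (θ : S → ℝ) (hθ : ∀ η, 0 ≤ θ η)
    (F : S → ℝ) (hF : ∀ η, 0 < F η) :
    ∑ η : S, θ η * F η * (∑ ζ : S, c (η, ζ) * (Real.log (F ζ) - Real.log (F η))) ≤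
      2 * ∑ η : S, θ η * Real.sqrt (F η) *
        (∑ ζ : S, c (η, ζ) * (Real.sqrt (F ζ) - Real.sqrt (F η))) := by
  simp only [Finset.mul_sum]
  refine Finset.sum_le_sum fun η _ => Finset.sum_le_sum fun ζ _ => ?_
  have h := mul_le_mul_of_nonneg_left (mul_log_sub_log_le_two_mul_sqrt (hF η) (hF ζ))
    (mul_nonneg (hθ η) (hc (η, ζ)))
  linear_combination h
end

section
/- Symmetrization inequality for reversible kernels: for all positive functions F, G : S → ℝ (F(η) > 0 and G(η) > 0 for all η), one has Σ_{η∈S} θ(η) F(η) (A√G)(η) / √(G(η)) ≥ Σ_{η∈S} θ(η) √(F(η)) (A√F)(η). -/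
open Finset Real

/-- A double sum against a symmetric nonnegative weight is nonnegative as soon as the
symmetrization of the summand is. -/
theorem sum_sum_mul_nonneg_of_symm {S : Type*} [Fintype S] {w D : S → S → ℝ}
    (hw : ∀ η ζ, 0 ≤ w η ζ) (hsymm : ∀ η ζ, w η ζ = w ζ η)
    (hD : ∀ η ζ, 0 ≤ D η ζ + D ζ η) : 0 ≤ ∑ η, ∑ ζ, w η ζ * D η ζ := by
  have hswap : ∑ η, ∑ ζ, w η ζ * D η ζ = ∑ η, ∑ ζ, w η ζ * D ζ η := by
    rw [Finset.sum_comm]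
    exact Finset.sum_congr rfl fun η _ => Finset.sum_congr rfl fun ζ _ => by rw [hsymm]
  have hsum : 0 ≤ ∑ η, ∑ ζ, w η ζ * (D η ζ + D ζ η) :=
    Finset.sum_nonneg fun η _ => Finset.sum_nonneg fun ζ _ => mul_nonneg (hw η ζ) (hD η ζ)
  simp only [mul_add, Finset.sum_add_distrib] at hsum
  linarith

theorem two_mul_le_sq_mul_div_add_sq_mul_div {x y u v : ℝ} (hu : 0 < u) (hv : 0 < v) :
    2 * (x * y) ≤ x ^ 2 * (v / u) + y ^ 2 * (u / v) := by
  have h : x ^ 2 * (v / u) + y ^ 2 * (u / v) - 2 * (x * y) = (x * v - y * u) ^ 2 / (u * v) := by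
    field_simp
    ring
  have : 0 ≤ (x * v - y * u) ^ 2 / (u * v) := by positivity
  linarith

/-- Symmetrization inequality for reversible kernels: if the nonnegative kernel
`a` satisfies detailed balance `a(η,ζ) θ(η) = a(ζ,η) θ(ζ)` with respect to the nonnegative weight
`θ`, then for all positive `F, G`,
`Σ θ F (A√G)/√G ≥ Σ θ √F (A√F)`, where `(Aφ)(η) = Σ_ζ a(η,ζ)(φ(ζ) − φ(η))`. -/
theorem symmetrization_inequality_reversible {S : Type*} [Fintype S]
    (θ : S → ℝ) (hθ : ∀ η, 0 ≤ θ η)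
    (a : S × S → ℝ) (ha : ∀ q, 0 ≤ a q)
    (hsymm : ∀ η ζ : S, a (η, ζ) * θ η = a (ζ, η) * θ ζ)
    (F G : S → ℝ) (hF : ∀ η, 0 < F η) (hG : ∀ η, 0 < G η) :
    ∑ η : S, θ η * Real.sqrt (F η) *
        (∑ ζ : S, a (η, ζ) * (Real.sqrt (F ζ) - Real.sqrt (F η))) ≤
      ∑ η : S, θ η * F η *
        (∑ ζ : S, a (η, ζ) * (Real.sqrt (G ζ) - Real.sqrt (G η))) / Real.sqrt (G η) := by
  have key := sum_sum_mul_nonneg_of_symm (w := fun η ζ => a (η, ζ) * θ η)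
    (D := fun η ζ => √(F η) ^ 2 * (√(G ζ) / √(G η)) - √(F η) * √(F ζ))
    (fun η ζ => mul_nonneg (ha _) (hθ η)) hsymm fun η ζ => by
      have := two_mul_le_sq_mul_div_add_sq_mul_div (x := √(F η)) (y := √(F ζ))
        (Real.sqrt_pos.2 (hG η)) (Real.sqrt_pos.2 (hG ζ))
      linarith
  rw [← sub_nonneg, ← Finset.sum_sub_distrib]
  convert key using 2 with η
  have hg : √(G η) ≠ 0 := (Real.sqrt_pos.2 (hG η)).ne'
  rw [Finset.mul_sum, Finset.mul_sum, Finset.sum_div, ← Finset.sum_sub_distrib]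
  refine Finset.sum_congr rfl fun ζ _ => ?_
  rw [← Real.sq_sqrt (hF η).le, Real.sqrt_sq (Real.sqrt_nonneg _)]
  field_simp
  ring
end

section
/- Quantitative aperiodicity bound for characteristic functions of ℕ-valued laws: for every probability mass function p on ℕ (p_j ≥ 0, Σ_{j≥0} p_j = 1) and every t ∈ ℝ, one has | Σ_{j≥0} p_j e^{i j t} |² ≤ 1 − 2 p₀ p₁ (1 − cos t). -/
open Complex Real

theorem norm_add_mul_exp_I_mul_sq (a b t : ℝ) :
    ‖(a : ℂ) + b * Complex.exp (Complex.I * t)‖ ^ 2 =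
      (a + b) ^ 2 - 2 * a * b * (1 - Real.cos t) := by
  rw [mul_comm Complex.I, Complex.exp_mul_I, Complex.sq_norm, Complex.normSq_apply,
    ← Complex.ofReal_cos, ← Complex.ofReal_sin]
  simp only [Complex.add_re, Complex.add_im, Complex.mul_re, Complex.mul_im, Complex.ofReal_re,
    Complex.ofReal_im, Complex.I_re, Complex.I_im]
  linear_combination b ^ 2 * Real.sin_sq_add_cos_sq t

/-- Quantitative aperiodicity bound for characteristic functions of ℕ-valued
laws: for every probability mass function `p` on ℕ and every `t ∈ ℝ`,
`|Σ_j p_j e^{ijt}|² ≤ 1 − 2 p₀ p₁ (1 − cos t)`. -/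
theorem char_fun_aperiodicity_bound (p : ℕ → ℝ) (hp : ∀ j, 0 ≤ p j) (hsum : HasSum p 1)
    (t : ℝ) :
    ‖∑' j : ℕ, (p j : ℂ) * Complex.exp (Complex.I * (j : ℂ) * (t : ℂ))‖ ^ 2 ≤
      1 - 2 * p 0 * p 1 * (1 - Real.cos t) := by
  set f : ℕ → ℂ := fun j ↦ (p j : ℂ) * Complex.exp (Complex.I * (j : ℂ) * (t : ℂ)) with hf
  have hnorm (j : ℕ) : ‖f j‖ = p j := by
    have h : Complex.I * (j : ℂ) * (t : ℂ) = ((j * t : ℝ) : ℂ) * Complex.I := by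
      push_cast; ring
    simp only [hf]
    rw [h, norm_mul, Complex.norm_exp_ofReal_mul_I, mul_one, Complex.norm_real,
      Real.norm_of_nonneg (hp j)]
  have hsf : Summable f := .of_norm (by simpa only [hnorm] using hsum.summable)
  have htail : HasSum (fun j ↦ p (j + 2)) (1 - (p 0 + p 1)) := by
    simpa [Finset.sum_range_succ] using (hasSum_nat_add_iff' 2).2 hsum
  have hB : ‖∑' j, f (j + 2)‖ ≤ 1 - (p 0 + p 1) :=
    tsum_of_norm_bounded htail fun j ↦ (hnorm (j + 2)).le
  have hA : ‖f 0 + f 1‖ ^ 2 = (p 0 + p 1) ^ 2 - 2 * p 0 * p 1 * (1 - Real.cos t) := by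
    simpa [hf] using norm_add_mul_exp_I_mul_sq (p 0) (p 1) t
  have hA' : ‖f 0 + f 1‖ ≤ p 0 + p 1 := by
    simpa only [hnorm] using norm_add_le (f 0) (f 1)
  have hsplit : ∑' j, f j = (f 0 + f 1) + ∑' j, f (j + 2) := by
    simpa [Finset.sum_range_succ] using (hsf.sum_add_tsum_nat_add 2).symm
  have hr : 0 ≤ 1 - (p 0 + p 1) := (norm_nonneg _).trans hB
  calc ‖∑' j, f j‖ ^ 2 ≤ (‖f 0 + f 1‖ + (1 - (p 0 + p 1))) ^ 2 := by
        rw [hsplit]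
        gcongr
        exact (norm_add_le _ _).trans (by gcongr)
    _ ≤ 1 - 2 * p 0 * p 1 * (1 - Real.cos t) := by
        linarith [mul_le_mul_of_nonneg_right hA' hr]
end

section
/- Strict monotonicity and surjectivity of the mean density: if g satisfies the gap condition, then for every λ ≥ 0 the series Σ_{k≥0} k λ^k / g(k)! converges, so R(λ) is well defined; moreover R(0) = 0, R is continuous and strictly increasing on [0, ∞), and R(λ) → ∞ as λ → ∞, so that R is a bijection from [0, ∞) onto [0, ∞). -/
open Finset Real

/-- `gFact g k = g(k)! := g(1)g(2)⋯g(k)`, with `g(0)! = 1`. -/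
noncomputable def gFact (g : ℕ → ℝ) : ℕ → ℝ
  | 0 => 1
  | k + 1 => gFact g k * g (k + 1)

/-- The partition function `Z(λ) = Σ_k λ^k / g(k)!`. -/
noncomputable def Zfun (g : ℕ → ℝ) (l : ℝ) : ℝ := ∑' k : ℕ, l ^ k / gFact g k

/-- The mean density `R(λ) = Σ_k k λ^k / (g(k)! Z(λ))`. -/
noncomputable def Rfun (g : ℕ → ℝ) (l : ℝ) : ℝ :=
  ∑' k : ℕ, (k : ℝ) * l ^ k / (gFact g k * Zfun g l)

/-- The one-site equilibrium weight `n_λ(k) = λ^k / (g(k)! Z(λ))`. -/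
noncomputable def nWeight (g : ℕ → ℝ) (l : ℝ) (k : ℕ) : ℝ := l ^ k / (gFact g k * Zfun g l)

/-- The gap condition on the jump rate `g`: there are `n₀` and `c_g > 0` with
`g(n') − g(n) ≥ c_g` whenever `n' ≥ n + n₀`. -/
def GapCondition (g : ℕ → ℝ) : Prop :=
  ∃ n₀ : ℕ, ∃ cg : ℝ, 0 < cg ∧ ∀ n n' : ℕ, n + n₀ ≤ n' → cg ≤ g n' - g n

theorem gFact_pos {g : ℕ → ℝ} (hg : ∀ k : ℕ, 0 < k → 0 < g k) (k : ℕ) : 0 < gFact g k := by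
  induction k with
  | zero => simp [gFact]
  | succ k ih => exact mul_pos ih (hg _ k.succ_pos)

theorem GapCondition.mul_le {g : ℕ → ℝ} {n₀ : ℕ} {c : ℝ}
    (h : ∀ n n' : ℕ, n + n₀ ≤ n' → c ≤ g n' - g n) (m : ℕ) :
    ∀ k : ℕ, (m + 1) * n₀ ≤ k → (m + 1 : ℝ) * c + g 0 ≤ g k := by
  induction m with
  | zero =>
    intro k hk
    have := h 0 k (by lia)
    norm_num
    linarith
  | succ m ih =>
    intro k hk
    have h1 := ih ((m + 1) * n₀) le_rfl
    have h2 := h ((m + 1) * n₀) k (by lia)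
    push_cast
    linarith

theorem GapCondition.tendsto_atTop {g : ℕ → ℝ} (h : GapCondition g) :
    Filter.Tendsto g Filter.atTop Filter.atTop := by
  obtain ⟨n₀, c, hc, h⟩ := h
  refine Filter.tendsto_atTop.2 fun B => ?_
  obtain ⟨m, hm⟩ := exists_nat_gt ((B - g 0) / c)
  filter_upwards [Filter.eventually_ge_atTop ((m + 1) * n₀)] with k hk
  have h1 := GapCondition.mul_le h m k hk
  rw [div_lt_iff₀ hc] at hm
  linarith

theorem summable_pow_div_gFact {g : ℕ → ℝ} (hg : ∀ k : ℕ, 0 < k → 0 < g k)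
    (h : GapCondition g) {l : ℝ} (hl : 0 ≤ l) : Summable fun k : ℕ => l ^ k / gFact g k := by
  refine summable_of_ratio_norm_eventually_le (r := 1 / 2) (by norm_num) ?_
  have h1 := (h.tendsto_atTop.comp (Filter.tendsto_add_atTop_nat 1)).eventually_ge_atTop (2 * l)
  filter_upwards [h1] with k hk
  have hG := gFact_pos hg k
  have hgk := hg (k + 1) k.succ_pos
  simp only [Function.comp] at hk
  rw [Real.norm_of_nonneg (div_nonneg (pow_nonneg hl _) (gFact_pos hg _).le),
    Real.norm_of_nonneg (div_nonneg (pow_nonneg hl _) hG.le)]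
  have h2 : l ^ (k + 1) / gFact g (k + 1) = l / g (k + 1) * (l ^ k / gFact g k) := by
    simp only [gFact]
    field_simp
    ring
  rw [h2]
  refine mul_le_mul_of_nonneg_right ?_ (div_nonneg (pow_nonneg hl _) hG.le)
  rw [div_le_iff₀ hgk]
  linarith

theorem summable_mul_pow_div_gFact {g : ℕ → ℝ} (hg : ∀ k : ℕ, 0 < k → 0 < g k)
    (h : GapCondition g) {l : ℝ} (hl : 0 ≤ l) :
    Summable fun k : ℕ => (k : ℝ) * l ^ k / gFact g k := by
  refine Summable.of_nonneg_of_le (fun k => ?_) (fun k => ?_)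
    (summable_pow_div_gFact hg h (mul_nonneg zero_le_two hl))
  · exact div_nonneg (by positivity) (gFact_pos hg k).le
  · have hk : (k : ℝ) ≤ 2 ^ k := by exact_mod_cast Nat.lt_two_pow_self.le
    rw [mul_pow]
    have := gFact_pos hg k
    gcongr

theorem Zfun_pos {g : ℕ → ℝ} (hg : ∀ k : ℕ, 0 < k → 0 < g k)
    (h : GapCondition g) {l : ℝ} (hl : 0 ≤ l) : 0 < Zfun g l :=
  (summable_pow_div_gFact hg h hl).tsum_pos
    (fun k => div_nonneg (pow_nonneg hl _) (gFact_pos hg k).le) 0 (by simp [gFact])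

theorem Rfun_eq_tsum_div (g : ℕ → ℝ) (l : ℝ) :
    Rfun g l = (∑' k : ℕ, (k : ℝ) * l ^ k / gFact g k) / Zfun g l := by
  simp only [Rfun, ← div_div, tsum_div_const]

theorem summable_sub_mul_pow_div_gFact {g : ℕ → ℝ} (hg : ∀ k : ℕ, 0 < k → 0 < g k)
    (h : GapCondition g) {l : ℝ} (hl : 0 ≤ l) (r : ℝ) :
    Summable fun k : ℕ => ((k : ℝ) - r) * (l ^ k / gFact g k) :=
  ((summable_mul_pow_div_gFact hg h hl).sub ((summable_pow_div_gFact hg h hl).mul_left r)).congr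
    fun k => by ring

theorem tsum_sub_mul_pow_div_gFact {g : ℕ → ℝ} (hg : ∀ k : ℕ, 0 < k → 0 < g k)
    (h : GapCondition g) {l : ℝ} (hl : 0 ≤ l) (r : ℝ) :
    ∑' k : ℕ, ((k : ℝ) - r) * (l ^ k / gFact g k) = (Rfun g l - r) * Zfun g l := by
  have hZ := (Zfun_pos hg h hl).ne'
  rw [Rfun_eq_tsum_div, sub_mul, div_mul_cancel₀ _ hZ, Zfun, ← tsum_mul_left,
    ← (summable_mul_pow_div_gFact hg h hl).tsum_sub ((summable_pow_div_gFact hg h hl).mul_left r)]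
  exact tsum_congr fun k => by ring

theorem Rfun_zero (g : ℕ → ℝ) : Rfun g 0 = 0 := by
  rw [Rfun, tsum_congr (g := fun _ => (0 : ℝ)), tsum_zero]
  rintro (_ | k) <;> simp

theorem Rfun_nonneg {g : ℕ → ℝ} (hg : ∀ k : ℕ, 0 < k → 0 < g k)
    (h : GapCondition g) {l : ℝ} (hl : 0 ≤ l) : 0 ≤ Rfun g l :=
  tsum_nonneg fun k => div_nonneg (by positivity)
    (mul_pos (gFact_pos hg k) (Zfun_pos hg h hl)).le

theorem continuousOn_tsum_pow {a : ℕ → ℝ} (ha : ∀ k, 0 ≤ a k)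
    (h : ∀ l : ℝ, 0 ≤ l → Summable fun k : ℕ => a k * l ^ k) :
    ContinuousOn (fun l : ℝ => ∑' k : ℕ, a k * l ^ k) (Set.Ici 0) := by
  intro x (hx : 0 ≤ x)
  have h1 : ContinuousOn (fun l : ℝ => ∑' k : ℕ, a k * l ^ k) (Set.Icc 0 (x + 1)) := by
    refine continuousOn_tsum (fun k => by fun_prop) (h (x + 1) (by linarith)) ?_
    intro k y hy
    rw [Real.norm_of_nonneg (mul_nonneg (ha k) (pow_nonneg hy.1 _))]
    exact mul_le_mul_of_nonneg_left (pow_le_pow_left₀ hy.1 hy.2 k) (ha k)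
  refine (h1 x ⟨hx, by linarith⟩).mono_of_mem_nhdsWithin ?_
  rw [← Set.Ici_inter_Iic]
  exact inter_mem_nhdsWithin _ (Iic_mem_nhds (by linarith))

theorem continuousOn_Rfun {g : ℕ → ℝ} (hg : ∀ k : ℕ, 0 < k → 0 < g k)
    (h : GapCondition g) : ContinuousOn (Rfun g) (Set.Ici 0) := by
  have hS := continuousOn_tsum_pow (a := fun k => (k : ℝ) / gFact g k)
    (fun k => div_nonneg k.cast_nonneg (gFact_pos hg k).le)
    (fun l hl => (summable_mul_pow_div_gFact hg h hl).congr fun k => by ring)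
  have hZ := continuousOn_tsum_pow (a := fun k => 1 / gFact g k)
    (fun k => div_nonneg zero_le_one (gFact_pos hg k).le)
    (fun l hl => (summable_pow_div_gFact hg h hl).congr fun k => by ring)
  refine (hS.div (hZ.congr (g := Zfun g) ?_) fun l hl => (Zfun_pos hg h hl).ne').congr ?_
  · exact fun l _ => tsum_congr fun k => by ring
  · intro l _
    rw [Rfun_eq_tsum_div]
    simp only [Pi.div_apply]
    congr 1
    exact tsum_congr fun k => by ring

/-- `x ↦ t ^ x` is increasing for `t > 1`, so it lies on the same side of `t ^ r` as `x` of `r`. -/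
theorem sub_mul_rpow_le {t : ℝ} (ht : 1 < t) (r x : ℝ) : (x - r) * t ^ r ≤ (x - r) * t ^ x := by
  rcases le_total r x with hx | hx
  · exact mul_le_mul_of_nonneg_left (rpow_le_rpow_of_exponent_le ht.le hx) (sub_nonneg.2 hx)
  · exact mul_le_mul_of_nonpos_left (rpow_le_rpow_of_exponent_le ht.le hx) (sub_nonpos.2 hx)

theorem sub_mul_rpow_lt {t : ℝ} (ht : 1 < t) {r x : ℝ} (hx : r < x) :
    (x - r) * t ^ r < (x - r) * t ^ x :=
  mul_lt_mul_of_pos_left (rpow_lt_rpow_of_exponent_lt ht hx) (sub_pos.2 hx)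

theorem strictMonoOn_Rfun {g : ℕ → ℝ} (hg : ∀ k : ℕ, 0 < k → 0 < g k)
    (h : GapCondition g) : StrictMonoOn (Rfun g) (Set.Ici 0) := by
  intro a (ha : 0 ≤ a) b (hb : 0 ≤ b) hab
  have hb' : 0 < b := ha.trans_lt hab
  have hsum := summable_sub_mul_pow_div_gFact hg h hb (Rfun g a)
  suffices 0 < ∑' k : ℕ, ((k : ℝ) - Rfun g a) * (b ^ k / gFact g k) by
    rw [tsum_sub_mul_pow_div_gFact hg h hb] at this
    exact sub_pos.1 (pos_of_mul_pos_left this (Zfun_pos hg h hb).le)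
  rcases ha.eq_or_lt with rfl | ha'
  · rw [Rfun_zero] at hsum ⊢
    refine hsum.tsum_pos (fun k => ?_) 1 ?_
    · have := gFact_pos hg k
      rw [sub_zero]
      positivity
    · have := gFact_pos hg 1
      simp only [Nat.cast_one, sub_zero, one_mul, pow_one]
      positivity
  · have ht : 1 < b / a := (one_lt_div ha').2 hab
    have h0 : ∑' k : ℕ, (b / a) ^ Rfun g a * (((k : ℝ) - Rfun g a) * (a ^ k / gFact g k)) = 0 := by
      rw [tsum_mul_left, tsum_sub_mul_pow_div_gFact hg h ha, sub_self, zero_mul, mul_zero]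
    have hpow (k : ℕ) : ((k : ℝ) - Rfun g a) * (b ^ k / gFact g k) =
        ((k : ℝ) - Rfun g a) * (b / a) ^ (k : ℝ) * (a ^ k / gFact g k) := by
      rw [rpow_natCast, div_pow]
      field_simp
    have hw (k : ℕ) : 0 < a ^ k / gFact g k := div_pos (pow_pos ha' k) (gFact_pos hg k)
    obtain ⟨m, hm⟩ := exists_nat_gt (Rfun g a)
    rw [← h0]
    refine Summable.tsum_lt_tsum (i := m) (fun k => ?_) ?_
      ((summable_sub_mul_pow_div_gFact hg h ha _).mul_left _) hsum
    · rw [hpow, ← mul_assoc, mul_comm (_ ^ _)]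
      exact mul_le_mul_of_nonneg_right (sub_mul_rpow_le ht _ _) (hw k).le
    · rw [hpow, ← mul_assoc, mul_comm (_ ^ _)]
      exact mul_lt_mul_of_pos_right (sub_mul_rpow_lt ht hm) (hw m)

theorem tendsto_Rfun_atTop {g : ℕ → ℝ} (hg : ∀ k : ℕ, 0 < k → 0 < g k)
    (h : GapCondition g) : Filter.Tendsto (Rfun g) Filter.atTop Filter.atTop := by
  refine Filter.tendsto_atTop.2 fun B => ?_
  obtain ⟨N, hN⟩ := exists_nat_ge B
  have hG := gFact_pos hg
  filter_upwards [Filter.eventually_ge_atTop 1, Filter.eventually_ge_atTop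
    ((∑ k ∈ range N, (N : ℝ) / gFact g k) * gFact g (N + 1))] with l hl hl'
  have hl0 : 0 ≤ l := zero_le_one.trans hl
  refine hN.trans (sub_nonneg.1 (nonneg_of_mul_nonneg_left ?_ (Zfun_pos hg h hl0)))
  rw [← tsum_sub_mul_pow_div_gFact hg h hl0]
  refine le_trans ?_ ((summable_sub_mul_pow_div_gFact hg h hl0 N).sum_le_tsum (range (N + 2)) ?_)
  · rw [sum_range_succ, sum_range_succ, sub_self, zero_mul, add_zero, Nat.cast_add_one,
      add_sub_cancel_left, one_mul]
    have h1 : -(∑ k ∈ range N, (N : ℝ) / gFact g k) * l ^ N ≤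
        ∑ k ∈ range N, ((k : ℝ) - N) * (l ^ k / gFact g k) := by
      rw [← sum_neg_distrib, sum_mul]
      refine sum_le_sum fun k hk => ?_
      have h2 : l ^ k ≤ l ^ N := pow_le_pow_right₀ hl (mem_range.1 hk).le
      have h3 : (N : ℝ) * (l ^ k / gFact g k) ≤ N * (l ^ N / gFact g k) := by
        have := hG k
        gcongr
      have h4 : 0 ≤ (k : ℝ) * (l ^ k / gFact g k) := by
        have := hG k
        positivity
      calc -((N : ℝ) / gFact g k) * l ^ N = -(N * (l ^ N / gFact g k)) := by ring
        _ ≤ _ := by linarith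
    have h5 : (∑ k ∈ range N, (N : ℝ) / gFact g k) * l ^ N ≤ l ^ (N + 1) / gFact g (N + 1) := by
      rw [le_div_iff₀ (hG _), mul_right_comm, pow_succ']
      exact mul_le_mul_of_nonneg_right hl' (pow_nonneg hl0 N)
    linarith
  · intro k hk
    have : (N : ℝ) ≤ k := by
      rw [mem_range] at hk
      exact_mod_cast (by lia : N ≤ k)
    exact mul_nonneg (sub_nonneg.2 this) (div_nonneg (pow_nonneg hl0 k) (hG k).le)

/-- Strict monotonicity and surjectivity of the mean density: under the gap
condition, for every `λ ≥ 0` the series `Σ_k k λ^k / g(k)!` converges, `R(0) = 0`, `R` is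
continuous and strictly increasing on `[0,∞)`, `R(λ) → ∞` as `λ → ∞`, and `R` is a bijection
from `[0,∞)` onto `[0,∞)`. -/
theorem zrp_mean_density_bijective (g : ℕ → ℝ) (hg0 : g 0 = 0)
    (hgpos : ∀ k : ℕ, 0 < k → 0 < g k) (hgap : GapCondition g) :
    (∀ l : ℝ, 0 ≤ l → Summable (fun k : ℕ => (k : ℝ) * l ^ k / gFact g k)) ∧
      Rfun g 0 = 0 ∧
      ContinuousOn (Rfun g) (Set.Ici 0) ∧
      StrictMonoOn (Rfun g) (Set.Ici 0) ∧
      Filter.Tendsto (Rfun g) Filter.atTop Filter.atTop ∧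
      Set.BijOn (Rfun g) (Set.Ici 0) (Set.Ici 0) := by
  have hcont := continuousOn_Rfun hgpos hgap
  have hmono := strictMonoOn_Rfun hgpos hgap
  have htop := tendsto_Rfun_atTop hgpos hgap
  refine ⟨fun l hl => summable_mul_pow_div_gFact hgpos hgap hl, Rfun_zero g, hcont, hmono, htop,
    fun l hl => Rfun_nonneg hgpos hgap hl, hmono.injOn, ?_⟩
  intro y (hy : 0 ≤ y)
  obtain ⟨M, hM, hyM⟩ :=
    ((Filter.eventually_ge_atTop 0).and (htop.eventually_ge_atTop y)).exists
  obtain ⟨x, hx, rfl⟩ := intermediate_value_Icc hM (hcont.mono Set.Icc_subset_Ici_self)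
    ⟨(Rfun_zero g).trans_le hy, hyM⟩
  exact ⟨x, hx.1, rfl⟩
end

section
/- Riemann approximation of the microscopic Dirichlet form by the macroscopic entropy dissipation: let d ≥ 1, let p : ℤ^d → ℝ be a finitely supported nonnegative function with p(0) = 0, Σ_{x∈ℤ^d} p(x) = 1, Σ_{x∈ℤ^d} p(x) x = 0, and set A := (1/2) Σ_{x∈ℤ^d} p(x) x xᵀ. Let ψ : ℝ^d → ℝ be ℤ^d-periodic, three times continuously differentiable, with ψ(u) ≥ δ for all u and some δ > 0. Then there exists a constant C (depending on p, ψ and δ) such that for every integer N ≥ 1, | 4 N^{2−d} Σ_{x∈{0,…,N−1}^d} Σ_{z∈ℤ^d} p(z) ( √(ψ((x+z)/N)) − √(ψ(x/N)) ) √(ψ(x/N)) + ∫_{[0,1]^d} ( ∇ψ(u) · A ∇ψ(u) ) / ψ(u) du | ≤ C / N. -/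
open Finset Real MeasureTheory

/-- Embedding of an integer vector into `d`-dimensional Euclidean space. -/
noncomputable def embZ {d : ℕ} (x : Fin d → ℤ) : EuclideanSpace ℝ (Fin d) :=
  (WithLp.equiv 2 (Fin d → ℝ)).symm (fun i => (x i : ℝ))

theorem embZ_apply {d : ℕ} (k : Fin d → ℤ) (i : Fin d) : embZ k i = (k i : ℝ) := rfl

theorem embZ_add {d : ℕ} (k l : Fin d → ℤ) : embZ (fun i => k i + l i) = embZ k + embZ l := by
  ext i
  simp [embZ_apply]

/-- A continuous `ℤ^d`-periodic function is bounded. -/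
theorem exists_norm_le_of_periodic {d : ℕ} {X : Type*} [NormedAddCommGroup X]
    {F : EuclideanSpace ℝ (Fin d) → X} (hF : Continuous F)
    (hper : ∀ u (k : Fin d → ℤ), F (u + embZ k) = F u) : ∃ M : ℝ, 0 ≤ M ∧ ∀ u, ‖F u‖ ≤ M := by
  have hK : IsCompact (WithLp.toLp 2 '' Set.Icc (0 : Fin d → ℝ) 1) :=
    isCompact_Icc.image (PiLp.continuous_toLp 2 _)
  obtain ⟨M, hM⟩ := hK.exists_bound_of_continuousOn hF.continuousOn
  refine ⟨max M 0, le_max_right _ _, fun u => le_max_of_le_left ?_⟩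
  rw [← hper u fun i => -⌊u i⌋]
  refine hM _ ⟨fun i => Int.fract (u i), ⟨fun i => Int.fract_nonneg _,
    fun i => (Int.fract_lt_one _).le⟩, ?_⟩
  ext i
  simp [embZ_apply, Int.fract, sub_eq_add_neg]

theorem fderiv_periodic {d : ℕ} {X : Type*} [NormedAddCommGroup X] [NormedSpace ℝ X]
    {F : EuclideanSpace ℝ (Fin d) → X}
    (hper : ∀ u (k : Fin d → ℤ), F (u + embZ k) = F u) (u : EuclideanSpace ℝ (Fin d))
    (k : Fin d → ℤ) : fderiv ℝ F (u + embZ k) = fderiv ℝ F u := by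
  rw [← fderiv_comp_add_right]
  simp only [hper]

/-- A bound on the derivative's Lipschitz constant controls the first order Taylor remainder. -/
theorem abs_taylor_one_le {E : Type*} [NormedAddCommGroup E] [NormedSpace ℝ E] {f : E → ℝ}
    (hf : Differentiable ℝ f) {L : ℝ} (hL0 : 0 ≤ L)
    (hL : ∀ u v, ‖fderiv ℝ f u - fderiv ℝ f v‖ ≤ L * ‖u - v‖) (u h : E) :
    |f (u + h) - f u - fderiv ℝ f u h| ≤ L * ‖h‖ ^ 2 := by
  have key := (convex_closedBall u ‖h‖).norm_image_sub_le_of_norm_fderiv_le'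
    (f := f) (φ := fderiv ℝ f u) (C := L * ‖h‖) (x := u) (y := u + h)
    (fun x _ => hf x) (fun x hx => (hL x u).trans ?_) (by simp) (by simp)
  · simpa [pow_two, mul_assoc] using key
  · gcongr
    simpa [dist_eq_norm] using hx

/-- Sums of `N`-periodic functions over the discrete torus are translation invariant. -/
theorem sum_shift_of_periodic {d N : ℕ} (hN : 1 ≤ N) {G : (Fin d → ℤ) → ℝ}
    (hG : ∀ y k : Fin d → ℤ, G (fun i => y i + N * k i) = G y) (z : Fin d → ℤ) :
    ∑ x : Fin d → Fin N, G (fun i => (x i : ℤ) + z i) =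
      ∑ x : Fin d → Fin N, G (fun i => (x i : ℤ)) := by
  have hN' : (0 : ℤ) < N := by exact_mod_cast hN
  let σ : (Fin d → Fin N) → (Fin d → Fin N) := fun x i =>
    ⟨(((x i : ℤ) + z i) % N).toNat, by
      have h1 := Int.emod_nonneg ((x i : ℤ) + z i) hN'.ne'
      have h2 := Int.emod_lt_of_pos ((x i : ℤ) + z i) hN'
      omega⟩
  have hσ (x : Fin d → Fin N) (i : Fin d) : ((σ x i : ℕ) : ℤ) = ((x i : ℤ) + z i) % N :=
    Int.toNat_of_nonneg (Int.emod_nonneg _ hN'.ne')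
  have hinj : Function.Injective σ := by
    intro x y hxy
    ext i
    have h : ((x i : ℤ) + z i) % N = ((y i : ℤ) + z i) % N := by rw [← hσ, ← hσ, hxy]
    have h' : (x i : ℤ) ≡ y i [ZMOD N] := Int.ModEq.add_right_cancel' _ h
    have h'' := Int.natCast_modEq_iff.1 h'
    exact h''.eq_of_lt_of_lt (x i).2 (y i).2
  rw [← Function.Bijective.sum_comp (Finite.injective_iff_bijective.1 hinj)
    fun x : Fin d → Fin N => G (fun i => (x i : ℤ))]
  refine Finset.sum_congr rfl fun x _ => ?_
  rw [← hG (fun i => ((σ x i : ℕ) : ℤ)) fun i => ((x i : ℤ) + z i) / N]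
  congr 1
  ext i
  rw [hσ, Int.emod_add_mul_ediv]

/-- Left endpoint Riemann sums of a Lipschitz function on the unit cube. -/
theorem abs_riemann_sum_sub_integral_le {d N : ℕ} (hN : 1 ≤ N) {G : (Fin d → ℝ) → ℝ} {K : ℝ}
    (hK0 : 0 ≤ K) (hc : Continuous G) (hK : ∀ u v, |G u - G v| ≤ K * ‖u - v‖) :
    |((N : ℝ) ^ d)⁻¹ * ∑ x : Fin d → Fin N, G (fun i => (N : ℝ)⁻¹ * (x i : ℝ)) -
      ∫ u in Set.Icc (0 : Fin d → ℝ) 1, G u| ≤ K / N := by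
  have hN' : (0 : ℝ) < N := by exact_mod_cast hN
  let cell : (Fin d → Fin N) → Set (Fin d → ℝ) := fun x =>
    Set.univ.pi fun i => Set.Ico ((N : ℝ)⁻¹ * (x i : ℝ)) ((N : ℝ)⁻¹ * ((x i : ℝ) + 1))
  have hmem (x : Fin d → Fin N) (u : Fin d → ℝ) :
      u ∈ cell x ↔ ∀ i, (x i : ℝ) ≤ N * u i ∧ N * u i < x i + 1 := by
    simp only [cell, Set.mem_univ_pi, Set.mem_Ico, inv_mul_le_iff₀ hN', lt_inv_mul_iff₀ hN']
  have hmeas (x) : MeasurableSet (cell x) := MeasurableSet.univ_pi fun i => measurableSet_Ico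
  have hvol (x) : volume.real (cell x) = ((N : ℝ) ^ d)⁻¹ := by
    simp only [cell, measureReal_def, volume_pi_pi, Real.volume_Ico]
    rw [ENNReal.toReal_prod]
    simp [mul_add]
  have hvol_lt (x) : volume (cell x) < ⊤ := by
    simp only [cell, volume_pi_pi, Real.volume_Ico]
    exact ENNReal.prod_lt_top fun i _ => ENNReal.ofReal_lt_top
  have hsub (x) : cell x ⊆ Set.Icc (0 : Fin d → ℝ) 1 := by
    intro u hu
    rw [hmem] at hu
    refine ⟨fun i => ?_, fun i => ?_⟩
    · have := (hu i).1
      have h0 : (0 : ℝ) ≤ (x i : ℕ) := Nat.cast_nonneg _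
      exact nonneg_of_mul_nonneg_right (h0.trans this) hN'
    · have h1 := (hu i).2
      have h2 : ((x i : ℕ) : ℝ) + 1 ≤ N := by exact_mod_cast (x i).2
      have : N * u i < N * 1 := by linarith
      exact (lt_of_mul_lt_mul_left this hN'.le).le
  have hint : IntegrableOn G (Set.Icc (0 : Fin d → ℝ) 1) :=
    hc.continuousOn.integrableOn_compact isCompact_Icc
  have hdisj : Pairwise (Function.onFun Disjoint cell) := by
    intro x y hxy
    refine Set.disjoint_left.2 fun u hx hy => hxy ?_
    rw [hmem] at hx hy
    ext i
    have h1 : ((x i : ℕ) : ℝ) < (y i : ℕ) + 1 := (hx i).1.trans_lt (hy i).2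
    have h2 : ((y i : ℕ) : ℝ) < (x i : ℕ) + 1 := (hy i).1.trans_lt (hx i).2
    norm_cast at h1 h2
    omega
  have hunion : (Set.univ.pi fun _ : Fin d => Set.Ico (0 : ℝ) 1) = ⋃ x, cell x := by
    ext u
    simp only [Set.mem_iUnion]
    constructor
    · intro hu
      rw [Set.mem_univ_pi] at hu
      refine ⟨fun i => ⟨⌊N * u i⌋₊, ?_⟩, (hmem _ _).2 fun i =>
        ⟨Nat.floor_le (mul_nonneg hN'.le (hu i).1), Nat.lt_floor_add_one _⟩⟩
      rw [Nat.floor_lt (mul_nonneg hN'.le (hu i).1)]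
      simpa using mul_lt_mul_of_pos_left (hu i).2 hN'
    · rintro ⟨x, hx⟩
      refine Set.mem_univ_pi.2 fun i => ⟨(hsub x hx).1 i, ?_⟩
      have h1 := ((hmem _ _).1 hx i).2
      have h2 : ((x i : ℕ) : ℝ) + 1 ≤ N := by exact_mod_cast (x i).2
      exact lt_of_mul_lt_mul_left (by linarith : N * u i < N * 1) hN'.le
  have hsplit : ∫ u in Set.Icc (0 : Fin d → ℝ) 1, G u = ∑ x, ∫ u in cell x, G u := by
    rw [← integral_iUnion_fintype hmeas hdisj fun x => hint.mono_set (hsub x), ← hunion]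
    exact (setIntegral_congr_set Measure.univ_pi_Ico_ae_eq_Icc).symm
  rw [hsplit, Finset.mul_sum, ← Finset.sum_sub_distrib]
  have hcell (x : Fin d → Fin N) :
      |((N : ℝ) ^ d)⁻¹ * G (fun i => (N : ℝ)⁻¹ * (x i : ℝ)) - ∫ u in cell x, G u| ≤
        K * (N : ℝ)⁻¹ * ((N : ℝ) ^ d)⁻¹ := by
    have hconst : ((N : ℝ) ^ d)⁻¹ * G (fun i => (N : ℝ)⁻¹ * (x i : ℝ)) =
        ∫ _ in cell x, G (fun i => (N : ℝ)⁻¹ * (x i : ℝ)) := by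
      rw [setIntegral_const, hvol, smul_eq_mul]
    rw [hconst, ← integral_sub (f := fun _ => G _) (integrableOn_const (hvol_lt x).ne) (hint.mono_set (hsub x)),
      ← hvol x, ← Real.norm_eq_abs]
    refine norm_setIntegral_le_of_norm_le_const (hvol_lt x) fun u hu => ?_
    refine (hK _ _).trans (mul_le_mul_of_nonneg_left ?_ hK0)
    refine (pi_norm_le_iff_of_nonneg (by positivity)).2 fun i => ?_
    have hu' := Set.mem_univ_pi.1 hu i
    rw [mul_add, mul_one] at hu'
    rw [Pi.sub_apply, Real.norm_eq_abs, abs_le]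
    constructor <;> linarith [hu'.1, hu'.2, inv_pos.2 hN']
  refine (Finset.abs_sum_le_sum_abs _ _).trans ((Finset.sum_le_sum fun x _ => hcell x).trans ?_)
  rw [Finset.sum_const, Finset.card_univ, Fintype.card_fun, Fintype.card_fin, Fintype.card_fin,
    nsmul_eq_mul, Nat.cast_pow]
  apply le_of_eq
  field_simp

/-- Discrete summation by parts: the Dirichlet form equals its sum of squared increments. -/
theorem sum_increment_mul_eq {d N : ℕ} (hN : 1 ≤ N) {G : (Fin d → ℤ) → ℝ}
    (hG : ∀ y k : Fin d → ℤ, G (fun i => y i + N * k i) = G y) (z : Fin d → ℤ) :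
    ∑ x : Fin d → Fin N, (G (fun i => (x i : ℤ) + z i) - G (fun i => (x i : ℤ))) *
        G (fun i => (x i : ℤ)) =
      -(1 / 2) * ∑ x : Fin d → Fin N,
        (G (fun i => (x i : ℤ) + z i) - G (fun i => (x i : ℤ))) ^ 2 := by
  have h := sum_shift_of_periodic hN (G := fun y => G y ^ 2) (fun y k => by simp only [hG]) z
  rw [← sub_eq_zero, ← Finset.sum_sub_distrib] at h
  rw [Finset.mul_sum, ← sub_eq_zero, ← Finset.sum_sub_distrib, ← mul_zero (1 / 2 : ℝ), ← h,
    Finset.mul_sum]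
  exact Finset.sum_congr rfl fun x _ => by ring

theorem exists_fderiv_bounds_of_periodic {d : ℕ} {f : EuclideanSpace ℝ (Fin d) → ℝ}
    (hf : ContDiff ℝ 2 f) (hper : ∀ u (k : Fin d → ℤ), f (u + embZ k) = f u) :
    ∃ M L : ℝ, 0 ≤ M ∧ 0 ≤ L ∧ (∀ u, ‖fderiv ℝ f u‖ ≤ M) ∧
      ∀ u v, ‖fderiv ℝ f u - fderiv ℝ f v‖ ≤ L * ‖u - v‖ := by
  have hf' : ContDiff ℝ 1 (fderiv ℝ f) := hf.fderiv_right (by norm_num)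
  obtain ⟨M, hM0, hM⟩ := exists_norm_le_of_periodic hf'.continuous (fderiv_periodic hper)
  obtain ⟨L, hL0, hL⟩ := exists_norm_le_of_periodic (hf'.continuous_fderiv (by norm_num))
    (fderiv_periodic (fderiv_periodic hper))
  refine ⟨M, L, hM0, hL0, hM, fun u v => ?_⟩
  exact convex_univ.norm_image_sub_le_of_norm_fderiv_le
    (fun x _ => (hf'.differentiable (by norm_num)) x) (fun x _ => hL x) trivial trivial

theorem setIntegral_unitCube {d : ℕ} (g : EuclideanSpace ℝ (Fin d) → ℝ) :
    ∫ u in {u : EuclideanSpace ℝ (Fin d) | ∀ i, u i ∈ Set.Icc (0 : ℝ) 1}, g u =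
      ∫ v in Set.Icc (0 : Fin d → ℝ) 1, g (WithLp.toLp 2 v) := by
  rw [← (EuclideanSpace.volume_preserving_symm_measurableEquiv_toLp
    (Fin d)).symm.setIntegral_preimage_emb (MeasurableEquiv.measurableEmbedding _)]
  congr 2
  ext v
  simp [Pi.le_def, forall_and]

/-- Riemann approximation of the Dirichlet form along a single jump `z`. -/
theorem exists_dirichlet_form_jump_bound {d : ℕ} {f : EuclideanSpace ℝ (Fin d) → ℝ}
    (hf : ContDiff ℝ 2 f) (hper : ∀ u (k : Fin d → ℤ), f (u + embZ k) = f u)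
    (z : Fin d → ℤ) :
    ∃ C : ℝ, ∀ N : ℕ, 1 ≤ N →
      |4 * (N : ℝ) ^ ((2 : ℤ) - (d : ℤ)) *
          (∑ x : Fin d → Fin N,
            (f ((N : ℝ)⁻¹ • embZ (fun i => (x i : ℤ) + z i)) -
              f ((N : ℝ)⁻¹ • embZ (fun i => (x i : ℤ)))) *
            f ((N : ℝ)⁻¹ • embZ (fun i => (x i : ℤ)))) +
        ∫ u in {u : EuclideanSpace ℝ (Fin d) | ∀ i, u i ∈ Set.Icc (0 : ℝ) 1},
          2 * (fderiv ℝ f u (embZ z)) ^ 2| ≤ C / N := by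
  obtain ⟨M, L, hM0, hL0, hM, hL⟩ := exists_fderiv_bounds_of_periodic hf hper
  have hdiff : Differentiable ℝ f := hf.differentiable (by norm_num)
  set h : EuclideanSpace ℝ (Fin d) := embZ z
  obtain ⟨c, hc0, hc⟩ : ∃ c : ℝ, 0 ≤ c ∧
      ∀ u v : Fin d → ℝ, ‖WithLp.toLp 2 u - WithLp.toLp 2 v‖ ≤ c * ‖u - v‖ := by
    let e : (Fin d → ℝ) →L[ℝ] EuclideanSpace ℝ (Fin d) :=
      ((PiLp.continuousLinearEquiv 2 ℝ fun _ : Fin d => ℝ).symm : _ →L[ℝ] _)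
    exact ⟨‖e‖, norm_nonneg _, fun u v => e.le_opNorm (u - v)⟩
  let G : (Fin d → ℝ) → ℝ := fun v => (fderiv ℝ f (WithLp.toLp 2 v) h) ^ 2
  have hGc : Continuous G := by
    have h1 : Continuous (fderiv ℝ f) := hf.continuous_fderiv (by norm_num)
    have h2 : Continuous (WithLp.toLp 2 : (Fin d → ℝ) → EuclideanSpace ℝ (Fin d)) :=
      PiLp.continuous_toLp 2 _
    exact ((h1.comp h2).clm_apply continuous_const).pow 2
  have hbd (u) : |fderiv ℝ f u h| ≤ M * ‖h‖ := (fderiv ℝ f u).le_of_opNorm_le (hM u) h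
  have hsq (a b B ε : ℝ) (hB : |a + b| ≤ B) (hε : |a - b| ≤ ε) : |a ^ 2 - b ^ 2| ≤ B * ε := by
    rw [sq_sub_sq, abs_mul]
    exact mul_le_mul hB hε (abs_nonneg _) ((abs_nonneg _).trans hB)
  have hGL (u v) : |G u - G v| ≤ (2 * M * ‖h‖) * (L * c * ‖h‖) * ‖u - v‖ := by
    have hε : |fderiv ℝ f (WithLp.toLp 2 u) h - fderiv ℝ f (WithLp.toLp 2 v) h| ≤
        L * (c * ‖u - v‖) * ‖h‖ :=
      (fderiv ℝ f (WithLp.toLp 2 u) - fderiv ℝ f (WithLp.toLp 2 v)).le_of_opNorm_le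
        ((hL _ _).trans (mul_le_mul_of_nonneg_left (hc u v) hL0)) h
    have hB : |fderiv ℝ f (WithLp.toLp 2 u) h + fderiv ℝ f (WithLp.toLp 2 v) h| ≤
        2 * M * ‖h‖ :=
      (abs_add_le _ _).trans (by linarith [hbd (WithLp.toLp 2 u), hbd (WithLp.toLp 2 v)])
    exact (hsq _ _ _ _ hB hε).trans (le_of_eq (by ring))
  refine ⟨2 * ((2 * M * ‖h‖) * (L * ‖h‖ ^ 2)) + 2 * ((2 * M * ‖h‖) * (L * c * ‖h‖)),
    fun N hN => ?_⟩
  have hN' : (0 : ℝ) < N := by exact_mod_cast hN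
  have hR := abs_riemann_sum_sub_integral_le hN (by positivity) hGc hGL
  have hparts := sum_increment_mul_eq hN (G := fun y => f ((N : ℝ)⁻¹ • embZ y))
    (fun y k => by
      rw [← hper ((N : ℝ)⁻¹ • embZ y) k]
      congr 1
      ext i
      simp only [PiLp.smul_apply, PiLp.add_apply, embZ_apply, smul_eq_mul]
      push_cast
      field_simp) z
  have hinc (x : Fin d → Fin N) :
      |(N : ℝ) ^ 2 * (f ((N : ℝ)⁻¹ • embZ (fun i => (x i : ℤ) + z i)) -
          f ((N : ℝ)⁻¹ • embZ (fun i => (x i : ℤ)))) ^ 2 -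
        G (fun i => (N : ℝ)⁻¹ * (x i : ℝ))| ≤ (2 * M * ‖h‖) * (L * ‖h‖ ^ 2) / N := by
    set u : EuclideanSpace ℝ (Fin d) := (N : ℝ)⁻¹ • embZ (fun i => (x i : ℤ)) with hu
    have hGu : G (fun i => (N : ℝ)⁻¹ * (x i : ℝ)) = (fderiv ℝ f u h) ^ 2 := by
      simp only [G]
      congr 3
    rw [embZ_add, smul_add, ← hu, hGu, ← mul_pow]
    have hnorm : ‖(N : ℝ)⁻¹ • h‖ = (N : ℝ)⁻¹ * ‖h‖ := by
      rw [norm_smul, Real.norm_of_nonneg (by positivity)]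
    have hε : |N * (f (u + (N : ℝ)⁻¹ • h) - f u) - fderiv ℝ f u h| ≤ L * ‖h‖ ^ 2 / N := by
      have ht := abs_taylor_one_le hdiff hL0 hL u ((N : ℝ)⁻¹ • h)
      rw [map_smul, smul_eq_mul, hnorm] at ht
      calc |N * (f (u + (N : ℝ)⁻¹ • h) - f u) - fderiv ℝ f u h|
          = N * |f (u + (N : ℝ)⁻¹ • h) - f u - (N : ℝ)⁻¹ * fderiv ℝ f u h| := by
            rw [← abs_of_pos hN', ← abs_mul, abs_of_pos hN']
            congr 1
            field_simp
        _ ≤ N * (L * ((N : ℝ)⁻¹ * ‖h‖) ^ 2) := by gcongr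
        _ = L * ‖h‖ ^ 2 / N := by field_simp
    have hB1 : |N * (f (u + (N : ℝ)⁻¹ • h) - f u)| ≤ M * ‖h‖ := by
      have hm := convex_univ.norm_image_sub_le_of_norm_fderiv_le (𝕜 := ℝ)
        (fun x _ => hdiff x) (fun x _ => hM x) (Set.mem_univ u)
        (Set.mem_univ (u + (N : ℝ)⁻¹ • h))
      rw [add_sub_cancel_left, hnorm, Real.norm_eq_abs] at hm
      rw [abs_mul, abs_of_pos hN']
      calc (N : ℝ) * |f (u + (N : ℝ)⁻¹ • h) - f u| ≤ N * (M * ((N : ℝ)⁻¹ * ‖h‖)) := by gcongr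
        _ = M * ‖h‖ := by field_simp
    have hB : |N * (f (u + (N : ℝ)⁻¹ • h) - f u) + fderiv ℝ f u h| ≤ 2 * M * ‖h‖ :=
      (abs_add_le _ _).trans (by linarith [hbd u])
    exact (hsq _ _ _ _ hB hε).trans (le_of_eq (by ring))
  have hD : |((N : ℝ) ^ d)⁻¹ * ∑ x : Fin d → Fin N,
        ((N : ℝ) ^ 2 * (f ((N : ℝ)⁻¹ • embZ (fun i => (x i : ℤ) + z i)) -
          f ((N : ℝ)⁻¹ • embZ (fun i => (x i : ℤ)))) ^ 2 -
        G (fun i => (N : ℝ)⁻¹ * (x i : ℝ)))| ≤ (2 * M * ‖h‖) * (L * ‖h‖ ^ 2) / N := by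
    rw [abs_mul, abs_of_pos (by positivity), inv_mul_le_iff₀ (by positivity)]
    refine (Finset.abs_sum_le_sum_abs _ _).trans ((Finset.sum_le_sum fun x _ => hinc x).trans ?_)
    rw [Finset.sum_const, Finset.card_univ, Fintype.card_fun, Fintype.card_fin, Fintype.card_fin,
      nsmul_eq_mul, Nat.cast_pow]
  rw [Finset.sum_sub_distrib, ← Finset.mul_sum] at hD
  rw [hparts, setIntegral_unitCube, integral_const_mul, zpow_sub₀ hN'.ne', zpow_natCast]
  norm_cast at hD hR ⊢
  rw [abs_le] at hD hR ⊢
  simp only [div_eq_mul_inv] at hD hR ⊢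
  constructor <;> nlinarith [hD.1, hD.2, hR.1, hR.2]

theorem fderiv_sq_eq_of_sqrt {d : ℕ} {ψ : EuclideanSpace ℝ (Fin d) → ℝ}
    {u : EuclideanSpace ℝ (Fin d)} (hψ : DifferentiableAt ℝ ψ u) (hpos : 0 < ψ u)
    (h : EuclideanSpace ℝ (Fin d)) :
    4 * (fderiv ℝ (fun v => √(ψ v)) u h) ^ 2 = (∑ i, h i * gradient ψ u i) ^ 2 / ψ u := by
  have hg : fderiv ℝ ψ u h = ∑ i, h i * gradient ψ u i := by
    rw [← inner_gradient_left, PiLp.inner_apply]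
    simp
  rw [fderiv_sqrt hψ hpos.ne', ← hg, _root_.smul_apply, smul_eq_mul, mul_pow, div_pow,
    mul_pow, Real.sq_sqrt hpos.le]
  field_simp
  norm_num

/-- Riemann approximation of the microscopic Dirichlet form by the macroscopic
entropy dissipation: for `p` finitely supported, nonnegative, with `p(0) = 0`, mass one and zero
mean, `A = (1/2)Σ_z p(z) z zᵀ`, and `ψ` a ℤ^d-periodic `C³` function bounded below by `δ > 0`,
there is `C` with, for all `N ≥ 1`,
`|4 N^{2−d} Σ_{x∈{0,…,N−1}^d} Σ_z p(z)(√ψ((x+z)/N) − √ψ(x/N))√ψ(x/N)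
  + ∫_{[0,1]^d} (∇ψ · A ∇ψ)/ψ| ≤ C/N`. -/
theorem dirichlet_form_riemann_approximation (d : ℕ) (hd : 1 ≤ d)
    (p : (Fin d → ℤ) → ℝ) (hfin : (Function.support p).Finite) (hp : ∀ x, 0 ≤ p x)
    (hp0 : p 0 = 0) (hsum : ∑ᶠ x, p x = 1) (hmean : ∀ i : Fin d, ∑ᶠ x, p x * (x i : ℝ) = 0)
    (ψ : EuclideanSpace ℝ (Fin d) → ℝ) (hψper : ∀ (u : EuclideanSpace ℝ (Fin d))
      (k : Fin d → ℤ), ψ (u + embZ k) = ψ u)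
    (hψ : ContDiff ℝ 3 ψ) (δ : ℝ) (hδ : 0 < δ) (hψδ : ∀ u, δ ≤ ψ u) :
    ∃ C : ℝ, ∀ N : ℕ, 1 ≤ N →
      |4 * (N : ℝ) ^ ((2 : ℤ) - (d : ℤ)) *
          (∑ x : Fin d → Fin N, ∑ᶠ z : Fin d → ℤ, p z *
            (Real.sqrt (ψ ((N : ℝ)⁻¹ • embZ (fun i => (x i : ℤ) + z i))) -
              Real.sqrt (ψ ((N : ℝ)⁻¹ • embZ (fun i => (x i : ℤ))))) *
            Real.sqrt (ψ ((N : ℝ)⁻¹ • embZ (fun i => (x i : ℤ))))) +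
        ∫ u in {u : EuclideanSpace ℝ (Fin d) | ∀ i, u i ∈ Set.Icc (0:ℝ) 1},
          (∑ i : Fin d, ∑ j : Fin d,
            ((1 / 2) * ∑ᶠ z : Fin d → ℤ, p z * (z i : ℝ) * (z j : ℝ)) *
              gradient ψ u i * gradient ψ u j) / ψ u|
      ≤ C / N := by
  classical
  set S := hfin.toFinset
  have hmS (z) (hz : p z ≠ 0) : z ∈ S := hfin.mem_toFinset.2 hz
  have hpos (u) : 0 < ψ u := hδ.trans_le (hψδ u)
  have hf : ContDiff ℝ 2 fun u => √(ψ u) :=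
    (hψ.of_le (by norm_num)).sqrt fun u => (hpos u).ne'
  have hfper (u) (k : Fin d → ℤ) : √(ψ (u + embZ k)) = √(ψ u) := by rw [hψper]
  choose C hC using exists_dirichlet_form_jump_bound hf hfper
  refine ⟨∑ z ∈ S, p z * C z, fun N hN => ?_⟩
  have hquad (u : EuclideanSpace ℝ (Fin d)) :
      (∑ i : Fin d, ∑ j : Fin d,
        ((1 / 2) * ∑ᶠ z : Fin d → ℤ, p z * (z i : ℝ) * (z j : ℝ)) *
          gradient ψ u i * gradient ψ u j) / ψ u =
      ∑ z ∈ S, p z * (2 * (fderiv ℝ (fun v => √(ψ v)) u (embZ z)) ^ 2) := by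
    have hz (z : Fin d → ℤ) : 2 * (fderiv ℝ (fun v => √(ψ v)) u (embZ z)) ^ 2 =
        (1 / 2) * ((∑ i, (z i : ℝ) * gradient ψ u i) ^ 2 / ψ u) := by
      have := fderiv_sq_eq_of_sqrt (hψ.differentiable (by norm_num) u) (hpos u) (embZ z)
      simp only [embZ_apply] at this
      linarith
    have hA (i j : Fin d) : ∑ᶠ z : Fin d → ℤ, p z * (z i : ℝ) * (z j : ℝ) =
        ∑ z ∈ S, p z * (z i : ℝ) * (z j : ℝ) :=
      finsum_eq_sum_of_support_subset _ fun z h => hmS z fun h0 => h (by simp [h0])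
    simp only [hA, hz, sq (∑ i, _), Finset.mul_sum, Finset.sum_mul,
      Finset.sum_div]
    rw [Finset.sum_comm (s := S)]
    refine Finset.sum_congr rfl fun i _ => ?_
    rw [Finset.sum_comm (s := S)]
    exact Finset.sum_congr rfl fun j _ => Finset.sum_congr rfl fun z _ => by ring
  have hlhs (x : Fin d → Fin N) : ∑ᶠ z : Fin d → ℤ, p z *
      (√(ψ ((N : ℝ)⁻¹ • embZ (fun i => (x i : ℤ) + z i))) -
        √(ψ ((N : ℝ)⁻¹ • embZ (fun i => (x i : ℤ))))) *
      √(ψ ((N : ℝ)⁻¹ • embZ (fun i => (x i : ℤ)))) = ∑ z ∈ S, p z *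
      ((√(ψ ((N : ℝ)⁻¹ • embZ (fun i => (x i : ℤ) + z i))) -
        √(ψ ((N : ℝ)⁻¹ • embZ (fun i => (x i : ℤ))))) *
      √(ψ ((N : ℝ)⁻¹ • embZ (fun i => (x i : ℤ))))) := by
    simp only [mul_assoc]
    exact finsum_eq_sum_of_support_subset _ fun z h => hmS z fun h0 => h (by simp [h0])
  have hcube : IsCompact {u : EuclideanSpace ℝ (Fin d) | ∀ i, u i ∈ Set.Icc (0 : ℝ) 1} := by
    have hK := (isCompact_Icc (a := (0 : Fin d → ℝ)) (b := 1)).image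
      (PiLp.continuous_toLp 2 fun _ : Fin d => ℝ)
    convert hK using 1
    ext u
    refine ⟨fun hu => ⟨u, ⟨fun i => (hu i).1, fun i => (hu i).2⟩, rfl⟩, ?_⟩
    rintro ⟨v, hv, rfl⟩ i
    exact ⟨hv.1 i, hv.2 i⟩
  have hint (z) : IntegrableOn (fun u => p z * (2 * (fderiv ℝ (fun v => √(ψ v)) u (embZ z)) ^ 2))
      {u : EuclideanSpace ℝ (Fin d) | ∀ i, u i ∈ Set.Icc (0 : ℝ) 1} := by
    refine Continuous.continuousOn ?_ |>.integrableOn_compact hcube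
    have h1 := hf.continuous_fderiv (by norm_num)
    exact (((h1.clm_apply continuous_const).pow 2).const_mul 2).const_mul (p z)
  simp only [hquad, hlhs]
  rw [integral_finsetSum _ fun z _ => hint z, Finset.sum_comm, Finset.mul_sum,
    ← Finset.sum_add_distrib, Finset.sum_div]
  refine (Finset.abs_sum_le_sum_abs _ _).trans (Finset.sum_le_sum fun z _ => ?_)
  rw [← Finset.mul_sum, integral_const_mul, mul_left_comm, ← mul_add, abs_mul,
    abs_of_nonneg (hp z), mul_div_assoc]
  exact mul_le_mul_of_nonneg_left (hC z N hN) (hp z)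
end
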